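/- For every b ∈ F with b ≠ 1, K((b³+b²+1)(b³+b²+b)³/(1+b)⁴) = K((b³+b²+1)³(b³+b²+b)/(1+b)⁴). -/

import Mathlib

/-- The Kloosterman sum over `GF(2^m)`: `K(a) = ∑_{x ≠ 0} (-1)^{Tr(a·x + 1/x)}`. -/
noncomputable def Kl (m : ℕ) (a : GaloisField 2 m) : ℤ :=
  letI := Fintype.ofFinite (GaloisField 2 m)
  letI := Classical.decEq (GaloisField 2 m)
  ∑ x ∈ Finset.univ.erase (0 : GaloisField 2 m),
    (-1 : ℤ) ^ ((Algebra.trace (ZMod 2) (GaloisField 2 m) (a * x + x⁻¹)).val)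

set_option linter.unusedSectionVars false

section aux
variable {F : Type*} [Field F] [Finite F] [CharP F 2] (T : F →+ ZMod 2) (hT : ∀ x, T (x ^ 2) = T x)

lemma two_eq_zero_aux (F : Type*) [Field F] [CharP F 2] : (2 : F) = 0 := CharTwo.two_eq_zero

include hT in
lemma T_as (c y : F) (h : y = c ^ 2 + c) : T y = 0 := by
  rw [h, map_add, hT]; exact CharTwo.add_self_eq_zero _

include hT in
lemma T_eq (c x y : F) (h : x = y + (c ^ 2 + c)) : T x = T y := by
  rw [h, map_add, T_as T hT c _ rfl, add_zero]

include hT in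
lemma T_root (p r s : F) (hr : r ≠ 0) (hrs : r ≠ s) (h : r ^ 3 + p * r = s ^ 3 + p * s) :
    T (1 + p / r ^ 2) = 0 := by
  have h2 := two_eq_zero_aux F
  have h3 : s ^ 2 + r * s + r ^ 2 + p = 0 := by
    have : (r - s) * (s ^ 2 + r * s + r ^ 2 + p) = 0 := by linear_combination h
    rcases mul_eq_zero.1 this with h | h
    · exact absurd (sub_eq_zero.1 h) hrs
    · exact h
  apply T_as T hT (s / r)
  field_simp
  linear_combination h3 - (s ^ 2 + r * s) * h2

lemma q_ne (p r q : F) (hq : q ≠ 0) (h : r ^ 3 + p * r = q) : r ≠ 0 ∧ r ^ 2 + p ≠ 0 := by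
  constructor
  · rintro rfl; apply hq; rw [← h]; ring
  · intro h'; apply hq; rw [← h]; linear_combination r * h'

include hT in
lemma T_pq (p r q : F) (hq : q ≠ 0) (h : r ^ 3 + p * r = q) :
    T (1 + p ^ 3 / q ^ 2) = T (1 + p / r ^ 2) := by
  have h2 := two_eq_zero_aux F
  obtain ⟨hr, hp⟩ := q_ne p r q hq h
  apply T_eq T hT (p / (r ^ 2 + p))
  have : q = r * (r ^ 2 + p) := by rw [← h]; ring
  rw [this]
  field_simp
  grind

include hT in
lemma uniq_root (p q r s : F) (hq : q ≠ 0) (hTq : T (1 + p ^ 3 / q ^ 2) = 1)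
    (hr : r ^ 3 + p * r = q) (hs : s ^ 3 + p * s = q) : r = s := by
  by_contra hne
  have := T_root T hT p r s (q_ne p r q hq hr).1 hne (hr.trans hs.symm)
  rw [T_pq T hT p r q hq hr, this] at hTq
  exact zero_ne_one hTq

include hT in
lemma ex_root (p q : F) (hq : q ≠ 0) (hTq : T (1 + p ^ 3 / q ^ 2) = 1) :
    ∃ r, r ^ 3 + p * r = q := by
  by_cases hp : p = 0
  · subst hp
    have hinj : Function.Injective (fun x : F => x ^ 3) := by
      intro r s hrs
      simp only at hrs
      by_cases hr : r = 0
      · subst hr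
        have : s ^ 3 = 0 := by rw [← hrs]; ring
        exact (pow_eq_zero_iff (by norm_num)).1 this |>.symm
      · by_contra hne
        have := T_root T hT 0 r s hr hne (by linear_combination hrs)
        simp at this hTq
        rw [this] at hTq
        exact zero_ne_one hTq
    obtain ⟨r, hr⟩ := Finite.surjective_of_injective hinj q
    exact ⟨r, by simpa using hr⟩
  · let U := {x : F // x ≠ 0 ∧ T (1 + p / x ^ 2) = 1}
    have hpx : ∀ x : F, x ≠ 0 → p ^ 3 / (x * p) ^ 2 = p / x ^ 2 := by
      intro x hx; field_simp
    have key : ∀ x : U, (x.1 ^ 3 + p * x.1) / p ≠ 0 ∧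
        T (1 + p / ((x.1 ^ 3 + p * x.1) / p) ^ 2) = 1 := by
      rintro ⟨x, hx, hTx⟩
      simp only
      have h0 : x ^ 3 + p * x ≠ 0 := by
        intro h
        have : T (1 + p / x ^ 2) = 0 :=
          T_root T hT p x 0 hx hx (by rw [h]; ring)
        rw [hTx] at this
        exact one_ne_zero this
      refine ⟨div_ne_zero h0 hp, ?_⟩
      rw [← hpx _ (div_ne_zero h0 hp), div_mul_cancel₀ _ hp, T_pq T hT p x _ h0 rfl, hTx]
    let f : U → U := fun x => ⟨_, key x⟩
    have hinj : Function.Injective f := by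
      rintro ⟨x, hx, hTx⟩ ⟨y, hy, hTy⟩ hxy
      have hxy' : (x ^ 3 + p * x) / p = (y ^ 3 + p * y) / p := congrArg Subtype.val hxy
      rw [div_left_inj' hp] at hxy'
      apply Subtype.ext
      by_contra hne
      have := T_root T hT p x y hx hne hxy'
      rw [hTx] at this
      exact one_ne_zero this
    have hqp : q / p ≠ 0 := div_ne_zero hq hp
    obtain ⟨⟨r, h1, h2⟩, hr⟩ := Finite.surjective_of_injective hinj
      ⟨q / p, hqp, by rw [← hpx _ hqp, div_mul_cancel₀ _ hp, hTq]⟩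
    have hr' : (r ^ 3 + p * r) / p = q / p := congrArg Subtype.val hr
    rw [div_left_inj' hp] at hr'
    exact ⟨r, hr'⟩

/-- relation between `x`, `r`, `z`. -/
lemma cubic_rel (a x : F) (hx : x + a ^ 2 ≠ 0) (z : F)
    (hz : z = x + (a ^ 2 / (x + a ^ 2)) + (a ^ 2 / (x + a ^ 2)) ^ 2) :
    (x / (x + a ^ 2)) ^ 3 + (z + 1 + a ^ 2) * (x / (x + a ^ 2)) = z := by
  have h2 := two_eq_zero_aux F
  rw [hz]
  field_simp
  grind

include hT in
lemma T_cubic (a z : F) (hz : z ≠ 0) :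
    T (1 + (z + 1 + a ^ 2) ^ 3 / z ^ 2) = T (z + a * (1 + a) ^ 3 / z) + T a := by
  have h2 := two_eq_zero_aux F
  rw [← map_add]
  have : T (z + a * (1 + a) ^ 3 / z + a) = T (z + a * (1 + a) ^ 3 / z + a ^ 2) := by
    rw [map_add, map_add _ _ (a ^ 2), hT]
  rw [this]
  apply T_eq T hT ((1 + a) ^ 3 / z)
  field_simp
  grind

lemma z_eq (a x : F) (hx : x + a ^ 2 ≠ 0) :
    x + (a ^ 2 / (x + a ^ 2)) + (a ^ 2 / (x + a ^ 2)) ^ 2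
      = x * (x + a ^ 2 + a) ^ 2 / (x + a ^ 2) ^ 2 := by
  have h2 := two_eq_zero_aux F
  field_simp
  grind

include hT in
lemma T_xz (a x z : F) (hx0 : x ≠ 0) (hx : x + a ^ 2 ≠ 0) (hx' : x + a ^ 2 + a ≠ 0)
    (hz : z = x + (a ^ 2 / (x + a ^ 2)) + (a ^ 2 / (x + a ^ 2)) ^ 2) :
    T (z + a * (1 + a) ^ 3 / z) = T (x + a ^ 3 * (1 + a) / x) := by
  have h2 := two_eq_zero_aux F
  apply T_eq T hT (a + a ^ 2 / (x + a ^ 2) + (1 + a) * (x + a ^ 2) / (x + a ^ 2 + a))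
  rw [z_eq a x hx] at hz
  rw [hz]
  field_simp
  grind

include hT in
lemma exc (a x : F) (hx0 : x ≠ 0) (h : T (x + a ^ 3 * (1 + a) / x) = T a + 1) :
    x + a ^ 2 ≠ 0 ∧ x + a ^ 2 + a ≠ 0 := by
  have h2 := two_eq_zero_aux F
  have hne : T a ≠ T a + 1 := by
    generalize T a = t; revert t; decide
  constructor
  · intro h0
    have hx : x = a ^ 2 := by linear_combination h0 - a ^ 2 * h2
    subst hx
    apply hne
    rw [← h]
    symm
    apply T_eq T hT 0
    have ha : a ≠ 0 := by rintro rfl; simp at hx0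
    field_simp
    grind
  · intro h0
    have hx : x = a ^ 2 + a := by linear_combination h0 - (a ^ 2 + a) * h2
    apply hne
    rw [← h]
    symm
    apply T_eq T hT 0
    have hx' : x = a * (1 + a) := by rw [hx]; ring
    have ha : a ≠ 0 := by rintro rfl; simp [hx'] at hx0
    have ha' : 1 + a ≠ 0 := by intro h; simp [hx', h] at hx0
    rw [hx']
    field_simp
    grind

include hT in
lemma card_eq [Fintype F] [DecidableEq F] (a : F) (ha : a ≠ 0) :
    (Finset.univ.filter (fun x : F => x ≠ 0 ∧ T (x + a ^ 3 * (1 + a) / x) = T a + 1)).card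
    = (Finset.univ.filter (fun x : F => x ≠ 0 ∧ T (x + a * (1 + a) ^ 3 / x) = T a + 1)).card := by
  have h2 := two_eq_zero_aux F
  have hone : T a + 1 + T a = 1 := by
    generalize T a = t; revert t; decide
  have hmem : ∀ x : F, x ≠ 0 → T (x + a ^ 3 * (1 + a) / x) = T a + 1 →
      (x + (a ^ 2 / (x + a ^ 2)) + (a ^ 2 / (x + a ^ 2)) ^ 2) ≠ 0 ∧
      T ((x + (a ^ 2 / (x + a ^ 2)) + (a ^ 2 / (x + a ^ 2)) ^ 2) + a * (1 + a) ^ 3 /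
        (x + (a ^ 2 / (x + a ^ 2)) + (a ^ 2 / (x + a ^ 2)) ^ 2)) = T a + 1 := by
    intro x hx0 hx
    obtain ⟨h3, h4⟩ := exc T hT a x hx0 hx
    refine ⟨?_, ?_⟩
    · rw [z_eq a x h3]
      exact div_ne_zero (mul_ne_zero hx0 (pow_ne_zero _ h4)) (pow_ne_zero _ h3)
    · rw [T_xz T hT a x _ hx0 h3 h4 rfl, hx]
  apply Finset.card_bij (fun x _ => x + (a ^ 2 / (x + a ^ 2)) + (a ^ 2 / (x + a ^ 2)) ^ 2)
  · intro x hx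
    simp only [Finset.mem_filter, Finset.mem_univ, true_and] at hx ⊢
    exact hmem x hx.1 hx.2
  · intro x hx y hy hxy
    simp only [Finset.mem_filter, Finset.mem_univ, true_and] at hx hy
    obtain ⟨hz0, hz⟩ := hmem x hx.1 hx.2
    have hx3 := (exc T hT a x hx.1 hx.2).1
    have hy3 := (exc T hT a y hy.1 hy.2).1
    have e1 := cubic_rel a x hx3 _ rfl
    have e2 := cubic_rel a y hy3 _ hxy
    have := uniq_root T hT _ _ _ _ hz0 (by rw [T_cubic T hT a _ hz0, hz, hone]) e1 e2
    rw [div_eq_div_iff hx3 hy3] at this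
    have h5 : a ^ 2 * (x - y) = 0 := by linear_combination this
    rcases mul_eq_zero.1 h5 with h | h
    · exact absurd h (pow_ne_zero _ ha)
    · exact sub_eq_zero.1 h
  · intro z hz
    simp only [Finset.mem_filter, Finset.mem_univ, true_and] at hz
    obtain ⟨hz0, hz⟩ := hz
    obtain ⟨r, hr⟩ := ex_root T hT (z + 1 + a ^ 2) z hz0
      (by rw [T_cubic T hT a _ hz0, hz, hone])
    have hr0 := (q_ne _ r z hz0 hr).1
    have hr1 : r + 1 ≠ 0 := by
      intro h
      have : r = 1 := by linear_combination h - h2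
      subst this
      apply pow_ne_zero 2 ha
      linear_combination hr - h2
    have hxa : a ^ 2 * r / (r + 1) + a ^ 2 = a ^ 2 / (r + 1) := by
      field_simp
      grind
    have ht : a ^ 2 / (a ^ 2 * r / (r + 1) + a ^ 2) = r + 1 := by
      rw [hxa]; field_simp
    have hx0 : a ^ 2 * r / (r + 1) ≠ 0 :=
      div_ne_zero (mul_ne_zero (pow_ne_zero _ ha) hr0) hr1
    have hx3 : a ^ 2 * r / (r + 1) + a ^ 2 ≠ 0 := by
      rw [hxa]; exact div_ne_zero (pow_ne_zero _ ha) hr1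
    have hzx : a ^ 2 * r / (r + 1) + (a ^ 2 / (a ^ 2 * r / (r + 1) + a ^ 2))
        + (a ^ 2 / (a ^ 2 * r / (r + 1) + a ^ 2)) ^ 2 = z := by
      rw [ht]
      field_simp
      grind
    have hx4 : a ^ 2 * r / (r + 1) + a ^ 2 + a ≠ 0 := by
      intro h
      apply hz0
      rw [← hzx, z_eq a _ hx3, h]
      simp
    refine ⟨a ^ 2 * r / (r + 1), ?_, hzx⟩
    simp only [Finset.mem_filter, Finset.mem_univ, true_and]
    exact ⟨hx0, by rw [← T_xz T hT a _ z hx0 hx3 hx4 hzx.symm, hz]⟩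

lemma sum_eq [Fintype F] [DecidableEq F] (A a : F) :
    ∑ x ∈ Finset.univ.erase (0 : F), (-1 : ℤ) ^ (T (A * x + x⁻¹)).val
    = (-1 : ℤ) ^ (T a).val * (((Finset.univ.erase (0 : F)).card : ℤ) - 2 *
      ((Finset.univ.filter (fun x : F => x ≠ 0 ∧ T (x + A / x) = T a + 1)).card : ℤ)) := by
  have h1 : ∑ x ∈ Finset.univ.erase (0 : F), (-1 : ℤ) ^ (T (A * x + x⁻¹)).val
      = ∑ x ∈ Finset.univ.erase (0 : F), (-1 : ℤ) ^ (T (x + A / x)).val := by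
    apply Finset.sum_bij (fun x _ => x⁻¹)
    · intro x hx; simpa using hx
    · intro x _ y _ h; exact inv_injective h
    · intro x hx; exact ⟨x⁻¹, by simpa using hx, inv_inv x⟩
    · intro x hx; rw [div_inv_eq_mul, add_comm]
  have h2 : ∀ s t : ZMod 2, (-1 : ℤ) ^ s.val
      = (-1 : ℤ) ^ t.val * (1 - 2 * (if s = t + 1 then 1 else 0)) := by decide
  have h3 : (Finset.univ.filter (fun x : F => x ≠ 0 ∧ T (x + A / x) = T a + 1))
      = (Finset.univ.erase (0 : F)).filter (fun x : F => T (x + A / x) = T a + 1) := by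
    ext x; simp
  rw [h1, h3, Finset.sum_congr rfl (fun x _ => h2 (T (x + A / x)) (T a)), ← Finset.mul_sum,
    Finset.sum_sub_distrib, ← Finset.mul_sum, Finset.sum_boole]
  simp

end aux

lemma trace_sq (m : ℕ) (x : GaloisField 2 m) :
    Algebra.trace (ZMod 2) (GaloisField 2 m) (x ^ 2)
      = Algebra.trace (ZMod 2) (GaloisField 2 m) x := by
  have := Algebra.trace_eq_of_algEquiv
    (FiniteField.frobeniusAlgEquiv (ZMod 2) (GaloisField 2 m) 2) x
  simpa [FiniteField.frobeniusAlgEquiv_apply] using this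

lemma Kl_main (m : ℕ) (a : GaloisField 2 m) :
    Kl m (a ^ 3 * (1 + a)) = Kl m (a * (1 + a) ^ 3) := by
  by_cases ha : a = 0
  · subst ha; simp
  letI := Fintype.ofFinite (GaloisField 2 m)
  letI := Classical.decEq (GaloisField 2 m)
  have e := fun A => sum_eq
    (Algebra.trace (ZMod 2) (GaloisField 2 m)).toAddMonoidHom A a
  have h := card_eq (Algebra.trace (ZMod 2) (GaloisField 2 m)).toAddMonoidHom
    (trace_sq m) a ha
  have e1 := e (a ^ 3 * (1 + a))
  have e2 := e (a * (1 + a) ^ 3)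
  rw [h] at e1
  exact e1.trans e2.symm

theorem cor3 (m : ℕ) (hm : 0 < m) (b : GaloisField 2 m) (hb : b ≠ 1) :
    Kl m ((b ^ 3 + b ^ 2 + 1) * (b ^ 3 + b ^ 2 + b) ^ 3 / (1 + b) ^ 4)
      = Kl m ((b ^ 3 + b ^ 2 + 1) ^ 3 * (b ^ 3 + b ^ 2 + b) / (1 + b) ^ 4) := by
  have h2 := two_eq_zero_aux (GaloisField 2 m)
  have hb' : 1 + b ≠ 0 := by
    intro h; apply hb; linear_combination h - h2
  have h1 : 1 + (b ^ 3 + b ^ 2 + 1) / (1 + b) = (b ^ 3 + b ^ 2 + b) / (1 + b) := by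
    field_simp
    linear_combination h2
  have := Kl_main m ((b ^ 3 + b ^ 2 + 1) / (1 + b))
  rw [h1] at this
  convert this.symm using 2
  · field_simp
  · field_simp
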